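/- arXiv:2405.19222 — 7 statements merged into one kernel-verified Lean document; each statement's English description precedes it below -/
import Mathlib

section
/- Let A be a PFSA over a finite alphabet Σ with finite state set Q. Then there exists a ReLU Elman RNN over Σ with hidden dimension D = |Q|·|Σ| (coordinates indexed by pairs (q,a) ∈ Q×Σ) and rational parameters U, V, b, η such that for every nonempty string y = y₁⋯y_t ∈ Σ* and every pair (q,a) ∈ Q×Σ, the hidden state satisfies h(y)_{(q,a)} = (if a = y_t then p_A(q, y) else 0), where p_A(q, y) is the state–string weight of A. -/
/-!
A probabilistic finite-state automaton (PFSA) over a finite alphabet `σ` with finite state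
set `Q`, and ReLU Elman RNNs with rational parameters and one-hot symbol embeddings.
-/

/-- A probabilistic finite-state automaton over alphabet `σ` with state set `Q`. -/
structure PFSA (σ Q : Type) [Fintype σ] [Fintype Q] where
  T : σ → Matrix Q Q ℚ
  init : Q → ℚ
  final : Q → ℚ
  T_nonneg : ∀ a q q', 0 ≤ T a q q'
  init_nonneg : ∀ q, 0 ≤ init q
  final_nonneg : ∀ q, 0 ≤ final q
  init_sum : ∑ q, init q = 1
  out_sum : ∀ q, (∑ a, ∑ q', T a q q') + final q = 1

/-- The prefix-weight row vector `h_A(y) = λᵀ T^(y₁) ⋯ T^(y_T)`; its `q`-entry is the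
state–string weight `p_A(q, y)`. -/
def PFSA.prefixVec {σ Q : Type} [Fintype σ] [Fintype Q] (A : PFSA σ Q) (y : List σ) :
    Q → ℚ :=
  y.foldl (fun v a => Matrix.vecMul v (A.T a)) A.init

/-- A ReLU Elman RNN over alphabet `σ` with hidden coordinates indexed by `D`,
with rational parameters. -/
structure ElmanRNN (σ D : Type) [Fintype σ] [Fintype D] where
  U : Matrix D D ℚ
  V : Matrix D σ ℚ
  bias : D → ℚ
  init : D → ℚ

/-- One-hot embedding of a symbol. -/
def oneHot {σ : Type} [DecidableEq σ] (a : σ) : σ → ℚ := fun a' => if a' = a then 1 else 0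

/-- The hidden-state map of a ReLU Elman RNN: `h(ε) = η` and
`h(y₁⋯y_t) = ReLU(U h(y₁⋯y_{t−1}) + V e_{y_t} + b)`. -/
def ElmanRNN.hid {σ D : Type} [Fintype σ] [Fintype D] [DecidableEq σ]
    (R : ElmanRNN σ D) (y : List σ) : D → ℚ :=
  y.foldl
    (fun v a => fun d => max 0 ((R.U.mulVec v + R.V.mulVec (oneHot a) + R.bias) d))
    R.init

namespace PFSA

variable {σ Q : Type} [Fintype σ] [Fintype Q] (A : PFSA σ Q)

theorem prefixVec_concat (w : List σ) (a : σ) :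
    A.prefixVec (w ++ [a]) = Matrix.vecMul (A.prefixVec w) (A.T a) := by
  simp [prefixVec]

theorem row_sum_le_one (a : σ) (q : Q) : ∑ q', A.T a q q' ≤ 1 := by
  have hle : ∑ q', A.T a q q' ≤ ∑ b, ∑ q', A.T b q q' :=
    Finset.single_le_sum (f := fun b => ∑ q', A.T b q q')
      (fun b _ => Finset.sum_nonneg fun q' _ => A.T_nonneg b q q') (Finset.mem_univ a)
  linarith [A.out_sum q, A.final_nonneg q]

theorem prefixVec_nonneg (w : List σ) (q : Q) : 0 ≤ A.prefixVec w q := by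
  induction w using List.reverseRecOn generalizing q with
  | nil => exact A.init_nonneg q
  | append_singleton w a ih =>
    rw [prefixVec_concat]
    exact Finset.sum_nonneg fun q' _ => mul_nonneg (ih q') (A.T_nonneg a q' q)

theorem sum_prefixVec_le_one (w : List σ) : ∑ q, A.prefixVec w q ≤ 1 := by
  induction w using List.reverseRecOn with
  | nil => exact A.init_sum.le
  | append_singleton w a ih =>
    calc ∑ q, A.prefixVec (w ++ [a]) q
        = ∑ q', A.prefixVec w q' * ∑ q, A.T a q' q := by
          simp only [prefixVec_concat, Matrix.vecMul, dotProduct, Finset.mul_sum]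
          exact Finset.sum_comm
      _ ≤ ∑ q', A.prefixVec w q' := Finset.sum_le_sum fun q' _ =>
          mul_le_of_le_one_right (A.prefixVec_nonneg w q') (A.row_sum_le_one a q')
      _ ≤ 1 := ih

theorem prefixVec_le_one (w : List σ) (q : Q) : A.prefixVec w q ≤ 1 :=
  (Finset.single_le_sum (fun q' _ => A.prefixVec_nonneg w q') (Finset.mem_univ q)).trans
    (A.sum_prefixVec_le_one w)

variable [DecidableEq σ]

/-- The RNN simulating `A`: block `a` of the recurrence applies `A.T a` to the sum of all blocks,
and the input weights push every block other than that of the current symbol below zero. -/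
def simulatingRNN : ElmanRNN σ (Q × σ) where
  U d d' := A.T d.2 d'.1 d.1
  V d a := if d.2 = a then 0 else -1
  bias _ := 0
  init d := A.init d.1 / Fintype.card σ

theorem simulatingRNN_hid_concat (w : List σ) (a : σ) (q : Q) (a' : σ)
    (hw : ∀ q, ∑ b, A.simulatingRNN.hid w (q, b) = A.prefixVec w q) :
    A.simulatingRNN.hid (w ++ [a]) (q, a') =
      if a' = a then A.prefixVec (w ++ [a]) q else 0 := by
  have hU : A.simulatingRNN.U.mulVec (A.simulatingRNN.hid w) (q, a') =
      A.prefixVec (w ++ [a']) q := by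
    simp only [prefixVec_concat, Matrix.mulVec, Matrix.vecMul, dotProduct, simulatingRNN,
      Fintype.sum_prod_type, ← Finset.mul_sum]
    exact Finset.sum_congr rfl fun q' _ => by rw [mul_comm, ← hw q']; rfl
  have hV : A.simulatingRNN.V.mulVec (oneHot a) (q, a') = if a' = a then 0 else -1 := by
    simp [Matrix.mulVec, dotProduct, simulatingRNN, oneHot]
  have hstep : A.simulatingRNN.hid (w ++ [a]) (q, a') =
      max 0 (A.simulatingRNN.U.mulVec (A.simulatingRNN.hid w) (q, a') +
        A.simulatingRNN.V.mulVec (oneHot a) (q, a') + 0) := by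
    simp only [ElmanRNN.hid, List.foldl_append, List.foldl_cons, List.foldl_nil]
    rfl
  rw [hstep, hU, hV]
  split_ifs with h
  · subst h
    simpa using A.prefixVec_nonneg (w ++ [a']) q
  · exact max_eq_left (by linarith [A.prefixVec_le_one (w ++ [a']) q])

theorem sum_simulatingRNN_hid [Nonempty σ] (w : List σ) (q : Q) :
    ∑ a, A.simulatingRNN.hid w (q, a) = A.prefixVec w q := by
  induction w using List.reverseRecOn generalizing q with
  | nil =>
    simp only [ElmanRNN.hid, simulatingRNN, prefixVec, List.foldl_nil, Finset.sum_const,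
      Finset.card_univ, nsmul_eq_mul]
    exact mul_div_cancel₀ _ (Nat.cast_ne_zero.mpr Fintype.card_ne_zero)
  | append_singleton w a ih =>
    simp [A.simulatingRNN_hid_concat w a q _ ih]

end PFSA

/-- For every PFSA `A` there is a ReLU Elman RNN with hidden dimension
`|Q|·|Σ|` (coordinates indexed by `Q × σ`) whose hidden state on any nonempty string
`w ++ [a]` stores, in coordinate `(q, a')`, the state–string weight `p_A(q, w ++ [a])`
if `a' = a` and `0` otherwise. -/
theorem pfsa_exact_hidden_simulation
    (σ Q : Type) [Fintype σ] [Fintype Q] [DecidableEq σ] (A : PFSA σ Q) :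
    ∃ R : ElmanRNN σ (Q × σ),
      ∀ (w : List σ) (a : σ) (q : Q) (a' : σ),
        R.hid (w ++ [a]) (q, a') =
          if a' = a then A.prefixVec (w ++ [a]) q else 0 := by
  refine ⟨A.simulatingRNN, fun w a q a' => ?_⟩
  have : Nonempty σ := ⟨a⟩
  exact A.simulatingRNN_hid_concat w a q a' (A.sum_simulatingRNN_hid w)
end

section
/- For every ReLU Elman RNN over a finite alphabet Σ with rational parameters U, V, b, η and one-hot symbol embeddings, there exists a constant C ∈ ℕ such that for every string y ∈ Σ* and every coordinate d of the hidden state, ψ(h(y)_d) ≤ C·(|y| + 1); i.e., such RNNs have linearly bounded precision. -/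
/-- The precision `ψ(x)` of a rational number: the minimum of
`⌈log₂ |p|⌉ + ⌈log₂ q⌉` over all representations `x = p / q` with `p ∈ ℤ`, `q ∈ ℕ`, `q ≠ 0`
(with the convention `⌈log₂ 0⌉ = 0`, as computed by `Nat.clog 2`). -/
noncomputable def precQ (x : ℚ) : ℕ :=
  sInf {n : ℕ | ∃ (p : ℤ) (q : ℕ), q ≠ 0 ∧ (p : ℚ) / (q : ℚ) = x ∧
    n = Nat.clog 2 p.natAbs + Nat.clog 2 q}

/-- A finite family of rational numbers has a common denominator. -/
theorem exists_common_denominator {ι : Type*} [Fintype ι] (f : ι → ℚ) :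
    ∃ M : ℕ, M ≠ 0 ∧ ∀ i, (M : ℚ) * f i ∈ (Int.castRingHom ℚ).range := by
  refine ⟨∏ i, (f i).den, Finset.prod_ne_zero_iff.2 fun i _ => (f i).den_nz, fun i => ?_⟩
  obtain ⟨k, hk⟩ := Finset.dvd_prod_of_mem (fun i => (f i).den) (Finset.mem_univ i)
  refine ⟨k * (f i).num, ?_⟩
  rw [hk]
  push_cast
  rw [eq_intCast]
  push_cast
  rw [← Rat.mul_den_eq_num (f i)]
  ring

/-- A finite family of rational numbers is bounded in absolute value by a natural number. -/
theorem exists_nat_abs_le {ι : Type*} [Fintype ι] (f : ι → ℚ) :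
    ∃ A : ℕ, ∀ i, |f i| ≤ A := by
  obtain ⟨A, hA⟩ := exists_nat_ge (∑ i, |f i|)
  exact ⟨A, fun i => (Finset.single_le_sum (f := fun i => |f i|)
    (fun j _ => abs_nonneg _) (Finset.mem_univ i)).trans hA⟩

theorem precQ_le_of_bounds {x : ℚ} {B M n K : ℕ} (hM : M ≠ 0)
    (hint : (M : ℚ) ^ n * x ∈ (Int.castRingHom ℚ).range) (hx : |x| ≤ (B : ℚ) ^ n)
    (hBM : B * M ≤ 2 ^ K) (hMK : M ≤ 2 ^ K) : precQ x ≤ 2 * K * n := by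
  obtain ⟨p, hp⟩ := hint
  rw [eq_intCast] at hp
  have hM0 : (0 : ℚ) < (M : ℚ) ^ n := by positivity
  have hpa : p.natAbs ≤ (B * M) ^ n := by
    have h : ((p.natAbs : ℕ) : ℚ) ≤ ((B * M : ℕ) : ℚ) ^ n := by
      rw [Nat.cast_natAbs, Int.cast_abs, hp, abs_mul, abs_of_pos hM0, Nat.cast_mul, mul_pow,
        mul_comm]
      gcongr
    exact_mod_cast h
  have hclog {m b : ℕ} (hm : m ≤ b ^ n) (hb : b ≤ 2 ^ K) : Nat.clog 2 m ≤ K * n := by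
    apply Nat.clog_le_of_le_pow
    rw [pow_mul]
    exact hm.trans (Nat.pow_le_pow_left hb n)
  have hle : precQ x ≤ Nat.clog 2 p.natAbs + Nat.clog 2 (M ^ n) := by
    refine Nat.sInf_le ⟨p, M ^ n, pow_ne_zero n hM, ?_, rfl⟩
    rw [hp, Nat.cast_pow, mul_div_cancel_left₀ _ hM0.ne']
  have h1 := hclog hpa hBM
  have h2 := hclog le_rfl hMK
  linarith

namespace ElmanRNN

variable {σ D : Type} [Fintype σ] [Fintype D] [DecidableEq σ] (R : ElmanRNN σ D)

theorem hid_concat (y : List σ) (a : σ) (d : D) :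
    R.hid (y ++ [a]) d = max 0 (∑ j, R.U d j * R.hid y j + R.V d a + R.bias d) := by
  simp [hid, List.foldl_append, Matrix.mulVec, dotProduct, oneHot]

theorem pow_mul_hid_mem_range {M : ℕ}
    (hU : ∀ d j, (M : ℚ) * R.U d j ∈ (Int.castRingHom ℚ).range)
    (hV : ∀ d a, (M : ℚ) * R.V d a ∈ (Int.castRingHom ℚ).range)
    (hb : ∀ d, (M : ℚ) * R.bias d ∈ (Int.castRingHom ℚ).range)
    (hi : ∀ d, (M : ℚ) * R.init d ∈ (Int.castRingHom ℚ).range) (y : List σ) (d : D) :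
    (M : ℚ) ^ (y.length + 1) * R.hid y d ∈ (Int.castRingHom ℚ).range := by
  induction y using List.reverseRecOn generalizing d with
  | nil => simpa [hid] using hi d
  | append_singleton y a ih =>
    rw [hid_concat, List.length_append, List.length_singleton]
    rcases max_choice 0 (∑ j, R.U d j * R.hid y j + R.V d a + R.bias d) with h | h <;> rw [h]
    · rw [mul_zero]
      exact zero_mem _
    · have key : (M : ℚ) ^ (y.length + 1 + 1) *
          (∑ j, R.U d j * R.hid y j + R.V d a + R.bias d) =
          ∑ j, (M * R.U d j) * (M ^ (y.length + 1) * R.hid y j) +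
            M ^ (y.length + 1) * (M * R.V d a) + M ^ (y.length + 1) * (M * R.bias d) := by
        rw [mul_add, mul_add, Finset.mul_sum]
        congr 1
        · congr 1
          · exact Finset.sum_congr rfl fun j _ => by ring
          · ring
        · ring
      rw [key]
      have hpow : (M : ℚ) ^ (y.length + 1) ∈ (Int.castRingHom ℚ).range :=
        pow_mem (natCast_mem _ M) _
      exact add_mem (add_mem (sum_mem fun j _ => mul_mem (hU d j) (ih j))
        (mul_mem hpow (hV d a))) (mul_mem hpow (hb d))

theorem abs_hid_le {A : ℕ} (hU : ∀ d j, |R.U d j| ≤ A) (hV : ∀ d a, |R.V d a| ≤ A)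
    (hb : ∀ d, |R.bias d| ≤ A) (hi : ∀ d, |R.init d| ≤ A) (y : List σ) (d : D) :
    |R.hid y d| ≤ (((Fintype.card D + 2) * A + 1 : ℕ) : ℚ) ^ (y.length + 1) := by
  set B : ℚ := (((Fintype.card D + 2) * A + 1 : ℕ) : ℚ) with hB
  have hB' : B = (Fintype.card D + 2) * A + 1 := by rw [hB]; push_cast; rfl
  have hA : (0 : ℚ) ≤ A := Nat.cast_nonneg A
  have hcA : (0 : ℚ) ≤ Fintype.card D * A := by positivity
  have hB1 : 1 ≤ B := by rw [hB']; linarith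
  induction y using List.reverseRecOn generalizing d with
  | nil =>
    have h := hi d
    simp only [hid, List.foldl_nil, List.length_nil, zero_add, pow_one]
    linarith
  | append_singleton y a ih =>
    rw [hid_concat, List.length_append, List.length_singleton, pow_succ]
    set P := B ^ (y.length + 1)
    have hP1 : 1 ≤ P := one_le_pow₀ hB1
    have hsum : |∑ j, R.U d j * R.hid y j| ≤ Fintype.card D * (A * P) := by
      refine (Finset.abs_sum_le_sum_abs _ _).trans ?_
      refine (Finset.sum_le_card_nsmul _ _ (A * P) fun j _ => ?_).trans_eq ?_
      · rw [abs_mul]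
        exact mul_le_mul (hU d j) (ih j) (abs_nonneg _) hA
      · rw [nsmul_eq_mul, Finset.card_univ]
    have hV' := hV d a
    have hb' := hb d
    have hmax : ∀ z : ℚ, |max 0 z| ≤ |z| := fun z => by
      rw [abs_of_nonneg (le_max_left 0 z)]
      exact max_le (abs_nonneg z) (le_abs_self z)
    have hAP : (A : ℚ) ≤ A * P := le_mul_of_one_le_right hA hP1
    calc _ ≤ |∑ j, R.U d j * R.hid y j + R.V d a + R.bias d| := hmax _
      _ ≤ |∑ j, R.U d j * R.hid y j| + |R.V d a| + |R.bias d| := abs_add_three _ _ _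
      _ ≤ Fintype.card D * (A * P) + A * P + A * P := by linarith
      _ ≤ P * B := by rw [hB']; linarith

end ElmanRNN

/-- Every ReLU Elman RNN with rational parameters and one-hot symbol
embeddings has linearly bounded precision: there is a constant `C ∈ ℕ` such that for every
string `y` and every hidden coordinate `d`, `ψ(h(y)_d) ≤ C · (|y| + 1)`. -/
theorem elmanRNN_linearly_bounded_precision
    (σ D : Type) [Fintype σ] [Fintype D] [DecidableEq σ] (R : ElmanRNN σ D) :
    ∃ C : ℕ, ∀ (y : List σ) (d : D), precQ (R.hid y d) ≤ C * (y.length + 1) := by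
  let params : (D × D) ⊕ (D × σ) ⊕ D ⊕ D → ℚ :=
    Sum.elim (fun p => R.U p.1 p.2) (Sum.elim (fun p => R.V p.1 p.2) (Sum.elim R.bias R.init))
  obtain ⟨M, hM, hint⟩ := exists_common_denominator params
  obtain ⟨A, hA⟩ := exists_nat_abs_le params
  set B := (Fintype.card D + 2) * A + 1
  have hK : B * M ≤ 2 ^ (B * M) := Nat.lt_two_pow_self.le
  refine ⟨2 * (B * M), fun y d => precQ_le_of_bounds hM ?_ ?_ hK
    ((Nat.le_mul_of_pos_left M (Nat.succ_pos _)).trans hK)⟩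
  · exact R.pow_mul_hid_mem_range (fun d j => hint (.inl (d, j)))
      (fun d a => hint (.inr (.inl (d, a)))) (fun d => hint (.inr (.inr (.inl d))))
      (fun d => hint (.inr (.inr (.inr d)))) y d
  · exact R.abs_hid_le (fun d j => hA (.inl (d, j))) (fun d a => hA (.inr (.inl (d, a))))
      (fun d => hA (.inr (.inr (.inl d)))) (fun d => hA (.inr (.inr (.inr d)))) y d
end

section
/- Let A be a PFSA over a finite alphabet Σ with finite state set Q, let h be the hidden-state map of the ReLU Elman RNN of dimension D = |Q|·|Σ| constructed to satisfy h(w)_{(q,a)} = (if a = last symbol of w then p_A(q, w) else 0) for nonempty w, and h(ε)_{(q,a)} = (if a = y₀ then λ_q else 0) for a fixed y₀ ∈ Σ. Define the output matrix E indexed by (Σ ∪ {EOS}) × (Q×Σ) by E_{a,(q,a'')} := ∑_{q'} T^(a)_{q,q'} for a ∈ Σ and E_{EOS,(q,a'')} := ρ_q. Then for every prefix w ∈ Σ* with positive prefix weight ∑_q p_A(q, w) > 0, the vector v := E · (h(w)/‖h(w)‖₁) lies in the standard probability simplex of ℝ^{Σ∪{EOS}} and satisfies v_ā = p_A(ā |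 w) for every ā ∈ Σ ∪ {EOS}. Consequently, the LM p_R defined by p_R(y) := p_R(EOS | y)·∏_{t=1}^{|y|} p_R(y_t | y_{<t}), where p_R(ā | w) := v_ā when ∑_q p_A(q,w) > 0 and p_R(y) := 0 if some prefix of y has zero prefix weight, satisfies p_R(y) = p_A(y) for every y ∈ Σ* (weak equivalence). -/
/-- The string probability `p_A(y) = h_A(y) · ρ`. -/
def PFSA.stringProb {σ Q : Type} [Fintype σ] [Fintype Q] (A : PFSA σ Q) (y : List σ) : ℚ :=
  ∑ q, A.prefixVec y q * A.final q

/-- The prefix weight `∑_q p_A(q, y)`. -/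
def PFSA.prefixWeight {σ Q : Type} [Fintype σ] [Fintype Q] (A : PFSA σ Q) (y : List σ) : ℚ :=
  ∑ q, A.prefixVec y q

/-- Conditional next-symbol probabilities of a PFSA given a prefix `w`; `none` plays the
role of `EOS`. -/
def PFSA.cond {σ Q : Type} [Fintype σ] [Fintype Q] (A : PFSA σ Q) (w : List σ) :
    Option σ → ℚ
  | some a => (∑ q, (∑ q', A.T a q q') * A.prefixVec w q) / A.prefixWeight w
  | none => (∑ q, A.final q * A.prefixVec w q) / A.prefixWeight w

/-- The output matrix `E`, indexed by `(Σ ∪ {EOS}) × (Q × Σ)`: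
`E_{a,(q,a'')} = ∑_{q'} T^(a)_{q,q'}` for `a ∈ Σ` and `E_{EOS,(q,a'')} = ρ_q`. -/
def PFSA.outMat {σ Q : Type} [Fintype σ] [Fintype Q] (A : PFSA σ Q) :
    Option σ → Q × σ → ℚ
  | some a, (q, _) => ∑ q', A.T a q q'
  | none, (q, _) => A.final q

namespace PFSA

variable {σ Q : Type} [Fintype σ] [Fintype Q] (A : PFSA σ Q)

theorem prefixVec_append (u v : List σ) :
    A.prefixVec (u ++ v) =
      v.foldl (fun x a => Matrix.vecMul x (A.T a)) (A.prefixVec u) := by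
  simp [prefixVec]

theorem prefixVec_append_singleton (u : List σ) (a : σ) (q : Q) :
    A.prefixVec (u ++ [a]) q = ∑ p, A.prefixVec u p * A.T a p q := by
  simp [prefixVec_append, Matrix.vecMul, dotProduct]

theorem prefixWeight_nil : A.prefixWeight [] = 1 := A.init_sum

theorem prefixWeight_append_singleton (u : List σ) (a : σ) :
    A.prefixWeight (u ++ [a]) = ∑ q, (∑ q', A.T a q q') * A.prefixVec u q := by
  simp only [prefixWeight, prefixVec_append_singleton]
  rw [Finset.sum_comm]
  refine Finset.sum_congr rfl fun q _ => ?_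
  rw [← Finset.mul_sum, mul_comm]

theorem cond_some (w : List σ) (a : σ) :
    A.cond w (some a) = A.prefixWeight (w ++ [a]) / A.prefixWeight w := by
  rw [prefixWeight_append_singleton, cond]

theorem cond_none (w : List σ) :
    A.cond w none = A.stringProb w / A.prefixWeight w := by
  simp only [cond, stringProb, mul_comm]

theorem cond_nonneg (w : List σ) (c : Option σ) : 0 ≤ A.cond w c := by
  have hw : ∀ u, 0 ≤ A.prefixWeight u := fun u =>
    Finset.sum_nonneg fun q _ => A.prefixVec_nonneg u q
  cases c with
  | some a => rw [cond_some]; exact div_nonneg (hw _) (hw _)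
  | none =>
    rw [cond_none]
    exact div_nonneg (Finset.sum_nonneg fun q _ =>
      mul_nonneg (A.prefixVec_nonneg w q) (A.final_nonneg q)) (hw _)

theorem sum_cond (w : List σ) (hw : A.prefixWeight w ≠ 0) : ∑ c, A.cond w c = 1 := by
  rw [Fintype.sum_option]
  simp only [cond]
  rw [← Finset.sum_div, ← add_div, div_eq_one_iff_eq hw, Finset.sum_comm,
    ← Finset.sum_add_distrib, prefixWeight]
  refine Finset.sum_congr rfl fun q _ => ?_
  rw [← Finset.sum_mul, ← add_mul, add_comm, A.out_sum, one_mul]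

/-- The output matrix maps a normalized hidden state that stores the prefix vector in the
block of a single symbol to the conditional next-symbol distribution. -/
theorem sum_outMat_mul_eq_cond [DecidableEq σ] (w : List σ) (b : σ) (x : Q × σ → ℚ)
    (hx : ∀ q a, x (q, a) = if a = b then A.prefixVec w q else 0) (c : Option σ) :
    ∑ d, A.outMat c d * (x d / ∑ d', |x d'|) = A.cond w c := by
  have hnorm : ∑ d', |x d'| = A.prefixWeight w := by
    rw [Fintype.sum_prod_type, prefixWeight]
    refine Finset.sum_congr rfl fun q _ => ?_
    simp [hx, apply_ite abs, abs_of_nonneg (A.prefixVec_nonneg w q)]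
  rw [hnorm, Fintype.sum_prod_type]
  cases c <;>
    simp [hx, outMat, cond, ite_div, mul_ite, Finset.sum_div, mul_div_assoc]

/-- The conditional probabilities of successive symbols telescope to a ratio of prefix
weights. -/
theorem prod_cond (u y : List σ)
    (hy : ∀ t, t ≤ y.length → A.prefixWeight (u ++ y.take t) ≠ 0) :
    ∏ t : Fin y.length, A.cond (u ++ y.take t) (some (y.get t)) =
      A.prefixWeight (u ++ y) / A.prefixWeight u := by
  induction y generalizing u with
  | nil =>
    have h0 := hy 0 le_rfl
    simp only [List.take_zero, List.append_nil] at h0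
    simp [div_self h0]
  | cons a y ih =>
    have ih' := ih (u ++ [a]) fun t ht => by
      simpa using hy (t + 1) (by simpa using ht)
    have h1 : A.prefixWeight (u ++ [a]) ≠ 0 := by simpa using hy 1 (by simp)
    simp only [List.append_assoc, List.singleton_append] at ih'
    refine (Fin.prod_univ_succ (n := y.length) _).trans ?_
    simp only [Fin.val_zero, List.take_zero, List.append_nil, Fin.val_succ,
      List.take_succ_cons, List.get_cons_succ', List.get_cons_zero]
    rw [ih', cond_some, mul_comm, div_mul_div_cancel₀ h1]

theorem prefixVec_append_eq_zero (u v : List σ) (hu : A.prefixWeight u = 0) :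
    A.prefixVec (u ++ v) = 0 := by
  induction v using List.reverseRecOn with
  | nil =>
    rw [List.append_nil]
    exact funext fun q => (Finset.sum_eq_zero_iff_of_nonneg
      fun q _ => A.prefixVec_nonneg u q).1 hu q (Finset.mem_univ q)
  | append_singleton v a ih =>
    ext q
    rw [← List.append_assoc, prefixVec_append_singleton]
    simp [ih]

end PFSA

/-- With the hidden-state map `h` of the constructed Elman RNN
(`h(w)_{(q,a)} = [a = last symbol of w]·p_A(q,w)` for nonempty `w`,
`h(ε)_{(q,a)} = [a = y₀]·λ_q`), for every prefix `w` with positive prefix weight the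
vector `v = E·(h(w)/‖h(w)‖₁)` lies in the probability simplex and equals the conditional
distribution `p_A(· | w)`; consequently the induced autoregressive LM `p_R` (with
`p_R(y) = 0` whenever some prefix of `y` has zero prefix weight) is weakly equivalent
to `p_A`. -/
theorem sparsemax_elman_weak_equivalence
    (σ Q : Type) [Fintype σ] [Fintype Q] [DecidableEq σ]
    (A : PFSA σ Q) (y₀ : σ) (h : List σ → Q × σ → ℚ)
    (h_nil : ∀ (q : Q) (a : σ), h [] (q, a) = if a = y₀ then A.init q else 0)
    (h_app : ∀ (w : List σ) (a : σ) (q : Q) (a' : σ),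
      h (w ++ [a]) (q, a') = if a' = a then A.prefixVec (w ++ [a]) q else 0) :
    (∀ w : List σ, 0 < A.prefixWeight w →
      (∀ c : Option σ, 0 ≤ ∑ d, A.outMat c d * (h w d / ∑ d', |h w d'|)) ∧
      (∑ c : Option σ, ∑ d, A.outMat c d * (h w d / ∑ d', |h w d'|)) = 1 ∧
      (∀ c : Option σ,
        (∑ d, A.outMat c d * (h w d / ∑ d', |h w d'|)) = A.cond w c)) ∧
    (∀ y : List σ,
      ((∀ t, t ≤ y.length → 0 < A.prefixWeight (y.take t)) →
        (∑ d, A.outMat none d * (h y d / ∑ d', |h y d'|)) *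
          ∏ t : Fin y.length,
            (∑ d, A.outMat (some (y.get t)) d *
              (h (y.take t.1) d / ∑ d', |h (y.take t.1) d'|)) =
          A.stringProb y) ∧
      ((¬ ∀ t, t ≤ y.length → 0 < A.prefixWeight (y.take t)) →
        A.stringProb y = 0)) := by
  have hcond : ∀ (w : List σ) (c : Option σ),
      ∑ d, A.outMat c d * (h w d / ∑ d', |h w d'|) = A.cond w c := by
    intro w
    rcases List.eq_nil_or_concat' w with rfl | ⟨u, a, rfl⟩
    · exact A.sum_outMat_mul_eq_cond [] y₀ _ h_nil
    · exact A.sum_outMat_mul_eq_cond _ a _ (h_app u a)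
  simp only [hcond]
  refine ⟨fun w hw => ⟨A.cond_nonneg w, A.sum_cond w hw.ne', fun _ => trivial⟩,
    fun y => ⟨fun hy => ?_, fun hy => ?_⟩⟩
  · have hprod := A.prod_cond [] y fun t ht => (hy t ht).ne'
    simp only [List.nil_append, A.prefixWeight_nil, div_one] at hprod
    have hw : A.prefixWeight y ≠ 0 := by simpa using (hy y.length le_rfl).ne'
    rw [hprod, A.cond_none, div_mul_cancel₀ _ hw]
  · push Not at hy
    obtain ⟨t, -, ht⟩ := hy
    have h0 : A.prefixWeight (y.take t) = 0 :=
      le_antisymm ht (Finset.sum_nonneg fun q _ => A.prefixVec_nonneg _ q)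
    have hv := A.prefixVec_append_eq_zero (y.take t) (y.drop t) h0
    rw [List.take_append_drop] at hv
    simp [PFSA.stringProb, hv]
end

section
/- Let A be a PFSA over a finite alphabet Σ whose induced language model is tight, i.e., ∑'_{y∈Σ*} p_A(y) = 1. Then for every ε > 0 there exists a rational η > 0 such that the total variation distance satisfies TVD(p_A, p_{A_η}) = (1/2)·∑'_{y∈Σ*} |p_A(y) − p_{A_η}(y)| < ε, where A_η is the η-perturbation of A. -/
/-- The string probability `p_{A_δ}(y)` of the `δ`-perturbation of a PFSA: all transition
weights and final weights are shifted by `δ` and renormalized by `1 + (|Σ||Q| + 1)·δ`,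
while the initial vector is unchanged. -/
noncomputable def PFSA.pertProb {σ Q : Type} [Fintype σ] [Fintype Q] (A : PFSA σ Q)
    (δ : ℝ) (y : List σ) : ℝ :=
  let Z : ℝ := 1 + ((Fintype.card σ * Fintype.card Q + 1 : ℕ) : ℝ) * δ
  ∑ q,
    (y.foldl
      (fun v a => Matrix.vecMul v (Matrix.of fun q q' => ((A.T a q q' : ℝ) + δ) / Z))
      (fun q => (A.init q : ℝ))) q *
    (((A.final q : ℝ) + δ) / Z)

open Filter Topology

/-- The total weight of a finite set of strings, started from a nonnegative vector `v`, is at most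
the mass of `v` when the transition and final weights are substochastic. -/
theorem exists_finset_sum_foldl_vecMul_le {σ Q : Type} [Fintype σ] [Fintype Q]
    (M : σ → Matrix Q Q ℝ) (r : Q → ℝ) (hM : ∀ a q q', 0 ≤ M a q q')
    (hout : ∀ q, (∑ a, ∑ q', M a q q') + r q ≤ 1) (n : ℕ) :
    ∃ L : Finset (List σ), (∀ y : List σ, y.length ≤ n → y ∈ L) ∧
      ∀ v : Q → ℝ, (∀ q, 0 ≤ v q) →
        ∑ y ∈ L, ∑ q, y.foldl (fun v a => Matrix.vecMul v (M a)) v q * r q ≤ ∑ q, v q := by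
  classical
  induction n with
  | zero =>
    refine ⟨{[]}, fun y hy => by simpa using hy, fun v hv => ?_⟩
    simp only [Finset.sum_singleton, List.foldl_nil]
    refine Finset.sum_le_sum fun q _ => mul_le_of_le_one_right (hv q) ?_
    have h : 0 ≤ ∑ a, ∑ q', M a q q' :=
      Finset.sum_nonneg fun a _ => Finset.sum_nonneg fun q' _ => hM a q q'
    linarith [hout q]
  | succ n ih =>
    obtain ⟨L, hL, hsum⟩ := ih
    refine ⟨insert [] ((Finset.univ ×ˢ L).image fun p : σ × List σ => p.1 :: p.2), ?_, ?_⟩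
    · rintro (_ | ⟨a, y⟩) hy
      · simp
      · have : y ∈ L := hL y (by simpa using hy)
        simp [this]
    · intro v hv
      rw [Finset.sum_insert (by simp), Finset.sum_image (by
        rintro ⟨a, y⟩ _ ⟨b, z⟩ _ h
        simpa using h), Finset.sum_product]
      simp only [List.foldl_nil, List.foldl_cons]
      have hstep : ∀ a, ∑ y ∈ L, ∑ q,
          y.foldl (fun v a => Matrix.vecMul v (M a)) (Matrix.vecMul v (M a)) q * r q ≤
            ∑ q, v q * ∑ q', M a q q' := by
        intro a
        refine (hsum _ fun q => ?_).trans_eq ?_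
        · exact Finset.sum_nonneg fun q' _ => mul_nonneg (hv q') (hM a q' q)
        · simp only [Matrix.vecMul, dotProduct, Finset.mul_sum]
          exact Finset.sum_comm
      calc _ ≤ ∑ q, v q * r q + ∑ a, ∑ q, v q * ∑ q', M a q q' := by
            gcongr with a
            exact hstep a
        _ = ∑ q, v q * ((∑ a, ∑ q', M a q q') + r q) := by
            rw [Finset.sum_comm, ← Finset.sum_add_distrib]
            refine Finset.sum_congr rfl fun q _ => ?_
            rw [mul_add, Finset.mul_sum, add_comm]
        _ ≤ ∑ q, v q :=
            Finset.sum_le_sum fun q _ => mul_le_of_le_one_right (hv q) (hout q)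

theorem foldl_vecMul_nonneg {σ Q : Type} [Fintype Q] (M : σ → Matrix Q Q ℝ)
    (hM : ∀ a q q', 0 ≤ M a q q') (y : List σ) :
    ∀ v : Q → ℝ, (∀ q, 0 ≤ v q) →
      ∀ q, 0 ≤ y.foldl (fun v a => Matrix.vecMul v (M a)) v q := by
  induction y with
  | nil => exact fun v hv => hv
  | cons a y ih =>
    exact fun v hv => ih _ fun q =>
      Finset.sum_nonneg fun q' _ => mul_nonneg (hv q') (hM a q' q)

theorem continuousAt_foldl_vecMul {X σ Q : Type} [TopologicalSpace X] [Fintype Q] {x : X}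
    (M : X → σ → Matrix Q Q ℝ) (hM : ∀ a, ContinuousAt (fun t => M t a) x) (y : List σ) :
    ∀ v : X → Q → ℝ, ContinuousAt v x →
      ContinuousAt (fun t => y.foldl (fun v a => Matrix.vecMul v (M t a)) (v t)) x := by
  induction y with
  | nil => exact fun v hv => hv
  | cons a y ih =>
    intro v hv
    refine ih (fun t => Matrix.vecMul (v t) (M t a)) ?_
    have hc : Continuous fun p : (Q → ℝ) × Matrix Q Q ℝ => Matrix.vecMul p.1 p.2 :=
      continuous_fst.matrix_vecMul continuous_snd
    exact hc.continuousAt.comp (hv.prodMk (hM a))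

namespace PFSA

variable {σ Q : Type} [Fintype σ] [Fintype Q] (A : PFSA σ Q)

theorem pertProb_zero (y : List σ) : A.pertProb 0 y = A.stringProb y := by
  have h : ∀ (v : Q → ℚ),
      y.foldl (fun v a => Matrix.vecMul v (Matrix.of fun q q' => (A.T a q q' : ℝ)))
        (fun q => (v q : ℝ)) =
      fun q => ((y.foldl (fun v a => Matrix.vecMul v (A.T a)) v q : ℚ) : ℝ) := by
    induction y with
    | nil => exact fun v => rfl
    | cons a y ih =>
      intro v
      rw [List.foldl_cons, List.foldl_cons, ← ih]
      congr 1
      ext q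
      simp [Matrix.vecMul, dotProduct]
  simp only [pertProb, stringProb, prefixVec, mul_zero, add_zero, div_one, h]
  push_cast
  rfl

theorem continuousAt_pertProb_zero (y : List σ) :
    ContinuousAt (fun δ => A.pertProb δ y) 0 := by
  have hdiv : ∀ c : ℝ, ContinuousAt (fun δ : ℝ =>
      (c + δ) / (1 + ((Fintype.card σ * Fintype.card Q + 1 : ℕ) : ℝ) * δ)) 0 := by
    intro c
    refine ContinuousAt.div (by fun_prop) (by fun_prop) (by simp)
  have hfold := continuousAt_foldl_vecMul (x := (0 : ℝ))
    (fun (δ : ℝ) a => Matrix.of fun q q' => ((A.T a q q' : ℝ) + δ) /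
      (1 + ((Fintype.card σ * Fintype.card Q + 1 : ℕ) : ℝ) * δ))
    (fun a => continuousAt_pi.2 fun q => continuousAt_pi.2 fun q' => hdiv _) y
    (fun _ q => (A.init q : ℝ)) continuousAt_const
  unfold pertProb
  exact tendsto_finsetSum _ fun q _ => (continuousAt_pi.1 hfold q).mul (hdiv _)

theorem pertProb_nonneg {δ : ℝ} (hδ : 0 ≤ δ) (y : List σ) : 0 ≤ A.pertProb δ y := by
  have hc : ∀ c : ℚ, 0 ≤ c →
      0 ≤ ((c : ℝ) + δ) / (1 + ((Fintype.card σ * Fintype.card Q + 1 : ℕ) : ℝ) * δ) := by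
    intro c h
    have : (0 : ℝ) ≤ c := by exact_mod_cast h
    positivity
  refine Finset.sum_nonneg fun q _ => mul_nonneg ?_ (hc _ (A.final_nonneg q))
  exact foldl_vecMul_nonneg _ (fun a q q' => hc _ (A.T_nonneg a q q')) y _
    (fun q => by exact_mod_cast A.init_nonneg q) q

theorem sum_pertProb_le_one {δ : ℝ} (hδ : 0 ≤ δ) (s : Finset (List σ)) :
    ∑ y ∈ s, A.pertProb δ y ≤ 1 := by
  have hc : ∀ c : ℚ, 0 ≤ c →
      0 ≤ ((c : ℝ) + δ) / (1 + ((Fintype.card σ * Fintype.card Q + 1 : ℕ) : ℝ) * δ) := by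
    intro c h
    have : (0 : ℝ) ≤ c := by exact_mod_cast h
    positivity
  obtain ⟨L, hL, hsum⟩ := exists_finset_sum_foldl_vecMul_le
    (fun a => Matrix.of fun q q' => ((A.T a q q' : ℝ) + δ) /
      (1 + ((Fintype.card σ * Fintype.card Q + 1 : ℕ) : ℝ) * δ))
    (fun q => ((A.final q : ℝ) + δ) /
      (1 + ((Fintype.card σ * Fintype.card Q + 1 : ℕ) : ℝ) * δ))
    (fun a q q' => hc _ (A.T_nonneg a q q'))
    (fun q => by
      have hout : (∑ a, ∑ q', (A.T a q q' : ℝ)) + (A.final q : ℝ) = 1 := by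
        exact_mod_cast A.out_sum q
      have hZ : 0 < 1 + ((Fintype.card σ * Fintype.card Q + 1 : ℕ) : ℝ) * δ := by positivity
      simp only [Matrix.of_apply, ← Finset.sum_div]
      rw [← add_div, div_le_one hZ]
      simp only [Finset.sum_add_distrib, Finset.sum_const, Finset.card_univ, nsmul_eq_mul]
      push_cast
      linarith) (s.sup List.length)
  calc ∑ y ∈ s, A.pertProb δ y ≤ ∑ y ∈ L, A.pertProb δ y :=
        Finset.sum_le_sum_of_subset_of_nonneg
          (fun y hy => hL y (Finset.le_sup (f := List.length) hy))
          fun y _ _ => A.pertProb_nonneg hδ y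
    _ ≤ ∑ q, (A.init q : ℝ) := hsum _ fun q => by exact_mod_cast A.init_nonneg q
    _ = 1 := by exact_mod_cast A.init_sum

end PFSA

/-- **Scheffé's lemma** for series: pointwise convergence of subprobability weights to a
probability weight implies convergence in `ℓ¹`. -/
theorem tendsto_tsum_abs_sub_of_sum_le_one {ι : Type*} {p : ι → ℝ} {u : ℕ → ι → ℝ}
    (hp0 : ∀ i, 0 ≤ p i) (hp : HasSum p 1) (hu0 : ∀ n i, 0 ≤ u n i)
    (hu : ∀ n (s : Finset ι), ∑ i ∈ s, u n i ≤ 1)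
    (hlim : ∀ i, Tendsto (fun n => u n i) atTop (𝓝 (p i))) :
    Tendsto (fun n => ∑' i, |p i - u n i|) atTop (𝓝 0) := by
  have hle : ∀ n i, max (p i - u n i) 0 ≤ p i := fun n i =>
    max_le (by linarith [hu0 n i]) (hp0 i)
  have hpos : Tendsto (fun n => ∑' i, max (p i - u n i) 0) atTop (𝓝 0) := by
    have h := tendsto_tsum_of_dominated_convergence (𝓕 := atTop)
      (f := fun n i => max (p i - u n i) 0) (g := fun _ => (0 : ℝ)) hp.summable
      (fun i => by
        have := ((tendsto_const_nhds (x := p i)).sub (hlim i)).max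
          (tendsto_const_nhds (x := (0 : ℝ)))
        simpa using this)
      (Eventually.of_forall fun n i => by
        rw [Real.norm_of_nonneg (le_max_right _ _)]
        exact hle n i)
    simpa using h
  refine squeeze_zero (fun n => tsum_nonneg fun i => abs_nonneg _) (fun n => ?_)
    (by simpa using hpos.const_mul 2)
  have hus : Summable (u n) := summable_of_sum_le (hu0 n) (hu n)
  have hms : Summable fun i => max (p i - u n i) 0 :=
    Summable.of_nonneg_of_le (fun i => le_max_right _ _) (hle n) hp.summable
  have habs : ∀ i, |p i - u n i| = 2 * max (p i - u n i) 0 + (u n i - p i) := by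
    intro i
    rcases le_total (p i - u n i) 0 with h | h
    · rw [abs_of_nonpos h, max_eq_right h]; ring
    · rw [abs_of_nonneg h, max_eq_left h]; ring
  simp only [habs]
  rw [(hms.mul_left 2).tsum_add (hus.sub hp.summable), tsum_mul_left,
    hus.tsum_sub hp.summable, hp.tsum_eq]
  linarith [hus.tsum_le_of_sum_le (hu n)]

/-- If the language model induced by a PFSA `A` is tight, then for every
`ε > 0` there is a rational `η > 0` such that the total variation distance between `p_A`
and the language model of the `η`-perturbation `A_η` is less than `ε`. -/
theorem perturbed_pfsa_tvd_small
    (σ Q : Type) [Fintype σ] [Fintype Q] (A : PFSA σ Q)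
    (htight : ∑' y : List σ, (A.stringProb y : ℝ) = 1) :
    ∀ ε : ℝ, 0 < ε → ∃ η : ℚ, 0 < η ∧
      (1 / 2) * (∑' y : List σ, |(A.stringProb y : ℝ) - A.pertProb (η : ℝ) y|) < ε := by
  intro ε hε
  have hsummable : Summable fun y : List σ => (A.stringProb y : ℝ) := by
    by_contra h
    rw [tsum_eq_zero_of_not_summable h] at htight
    exact zero_ne_one htight
  have hη : Tendsto (fun n : ℕ => (((1 / ((n : ℚ) + 1) : ℚ)) : ℝ)) atTop (𝓝 0) := by
    push_cast
    exact tendsto_one_div_add_atTop_nhds_zero_nat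
  have hη0 : ∀ n : ℕ, (0 : ℝ) ≤ ((1 / ((n : ℚ) + 1) : ℚ) : ℝ) := fun n => by
    push_cast
    positivity
  have hlim := tendsto_tsum_abs_sub_of_sum_le_one
    (p := fun y : List σ => (A.stringProb y : ℝ))
    (u := fun (n : ℕ) y => A.pertProb ((1 / ((n : ℚ) + 1) : ℚ) : ℝ) y)
    (fun y => by
      rw [← A.pertProb_zero]
      exact A.pertProb_nonneg le_rfl y)
    (htight ▸ hsummable.hasSum) (fun n => A.pertProb_nonneg (hη0 n))
    (fun n => A.sum_pertProb_le_one (hη0 n))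
    (fun y => by
      rw [← A.pertProb_zero]
      exact (A.continuousAt_pertProb_zero y).tendsto.comp hη)
  obtain ⟨n, hn⟩ := (hlim.eventually_lt_const hε).exists
  refine ⟨1 / ((n : ℚ) + 1), by positivity, ?_⟩
  have h0 : 0 ≤ ∑' y : List σ,
      |(A.stringProb y : ℝ) - A.pertProb ((1 / ((n : ℚ) + 1) : ℚ) : ℝ) y| :=
    tsum_nonneg fun y => abs_nonneg _
  linarith
end

section
/- For every N ∈ ℕ and every inverse temperature λ > 0, the softmax function with inverse temperature λ is λ-Lipschitz with respect to the Euclidean norm: for all x, y ∈ ℝ^N, ‖softmax(x) − softmax(y)‖₂ ≤ λ·‖x − y‖₂. -/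
/-- Softmax with inverse temperature `lam` on `ℝ^N`:
`softmax(x)_i = exp(lam·x_i) / ∑_j exp(lam·x_j)`. -/
noncomputable def softmaxFin {N : ℕ} (lam : ℝ) (x : Fin N → ℝ) (i : Fin N) : ℝ :=
  Real.exp (lam * x i) / ∑ j, Real.exp (lam * x j)

/-- On `(0, 1]` the logarithm has slope at least `1`. -/
lemma sq_sub_le_sub_mul_log_sub_log {p q : ℝ} (hp : 0 < p) (hp1 : p ≤ 1) (hq : 0 < q)
    (hq1 : q ≤ 1) : (p - q) ^ 2 ≤ (p - q) * (Real.log p - Real.log q) := by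
  wlog h : q ≤ p generalizing p q
  · linarith [this hq hq1 hp hp1 (le_of_not_ge h)]
  have h1 := Real.one_sub_inv_le_log_of_pos (div_pos hp hq)
  rw [Real.log_div hp.ne' hq.ne', inv_div] at h1
  have h2 : p - q ≤ 1 - q / p := by
    rw [one_sub_div hp.ne', le_div_iff₀ hp]
    nlinarith
  nlinarith

lemma softmaxFin_pos {N : ℕ} (lam : ℝ) (x : Fin N → ℝ) (i : Fin N) :
    0 < softmaxFin lam x i :=
  div_pos (Real.exp_pos _) (Finset.sum_pos (fun _ _ => Real.exp_pos _) ⟨i, Finset.mem_univ i⟩)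

lemma softmaxFin_le_one {N : ℕ} (lam : ℝ) (x : Fin N → ℝ) (i : Fin N) :
    softmaxFin lam x i ≤ 1 :=
  div_le_one_of_le₀
    (Finset.single_le_sum (f := fun j => Real.exp (lam * x j))
      (fun _ _ => (Real.exp_pos _).le) (Finset.mem_univ i))
    (Finset.sum_nonneg fun _ _ => (Real.exp_pos _).le)

lemma sum_softmaxFin {N : ℕ} [NeZero N] (lam : ℝ) (x : Fin N → ℝ) :
    ∑ i, softmaxFin lam x i = 1 := by
  have h : 0 < ∑ j, Real.exp (lam * x j) :=
    Finset.sum_pos (fun _ _ => Real.exp_pos _) Finset.univ_nonempty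
  simp only [softmaxFin]
  rw [← Finset.sum_div, div_self h.ne']

lemma log_softmaxFin {N : ℕ} (lam : ℝ) (x : Fin N → ℝ) (i : Fin N) :
    Real.log (softmaxFin lam x i) = lam * x i - Real.log (∑ j, Real.exp (lam * x j)) := by
  have h : 0 < ∑ j, Real.exp (lam * x j) :=
    Finset.sum_pos (fun _ _ => Real.exp_pos _) ⟨i, Finset.mem_univ i⟩
  rw [softmaxFin, Real.log_div (Real.exp_pos _).ne' h.ne', Real.log_exp]

/-- Co-coercivity of softmax. -/
lemma sum_sq_softmaxFin_sub_le {N : ℕ} (lam : ℝ) (x y : Fin N → ℝ) :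
    ∑ i, (softmaxFin lam x i - softmaxFin lam y i) ^ 2 ≤
      lam * ∑ i, (softmaxFin lam x i - softmaxFin lam y i) * (x i - y i) := by
  rcases N.eq_zero_or_pos with rfl | hN
  · simp
  have : NeZero N := ⟨hN.ne'⟩
  set c := Real.log (∑ j, Real.exp (lam * x j)) - Real.log (∑ j, Real.exp (lam * y j)) with hc
  have h0 : ∑ i, (softmaxFin lam x i - softmaxFin lam y i) * c = 0 := by
    rw [← Finset.sum_mul, Finset.sum_sub_distrib, sum_softmaxFin, sum_softmaxFin, sub_self,
      zero_mul]
  rw [← sub_zero (lam * _), ← h0, Finset.mul_sum, ← Finset.sum_sub_distrib]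
  refine Finset.sum_le_sum fun i _ => ?_
  have h := sq_sub_le_sub_mul_log_sub_log (softmaxFin_pos lam x i) (softmaxFin_le_one lam x i)
    (softmaxFin_pos lam y i) (softmaxFin_le_one lam y i)
  rw [log_softmaxFin, log_softmaxFin] at h
  rw [hc]
  linarith

/-- The softmax with inverse temperature `lam > 0` is `lam`-Lipschitz
with respect to the Euclidean norm on `ℝ^N`. -/
theorem softmax_lipschitz_euclidean (N : ℕ) (lam : ℝ) (hlam : 0 < lam)
    (x y : Fin N → ℝ) :
    Real.sqrt (∑ i, (softmaxFin lam x i - softmaxFin lam y i) ^ 2) ≤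
      lam * Real.sqrt (∑ i, (x i - y i) ^ 2) := by
  set D := ∑ i, (softmaxFin lam x i - softmaxFin lam y i) ^ 2 with hD
  have hD0 : 0 ≤ D := Finset.sum_nonneg fun _ _ => sq_nonneg _
  have hcs := Real.sum_mul_le_sqrt_mul_sqrt Finset.univ
    (fun i => softmaxFin lam x i - softmaxFin lam y i) (fun i => x i - y i)
  have h : √D * √D ≤ √D * (lam * √(∑ i, (x i - y i) ^ 2)) := by
    rw [Real.mul_self_sqrt hD0, mul_left_comm]
    exact (sum_sq_softmaxFin_sub_le lam x y).trans (mul_le_mul_of_nonneg_left hcs hlam.le)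
  rcases (Real.sqrt_nonneg D).eq_or_lt with h0 | h0
  · rw [← h0]
    positivity
  · exact le_of_mul_le_mul_left h h0
end

section
/- For every N ∈ ℕ and every inverse temperature λ > 0, the softmax function with inverse temperature λ is Lipschitz with respect to the supremum norm with constant λ·√N: for all x, y ∈ ℝ^N, ‖softmax(x) − softmax(y)‖_∞ ≤ λ·√N·‖x − y‖_∞. -/
/-- If the weights `A, B` and `A', B'` satisfy `A ≤ s A'` and `B' ≤ s B`, then the normalized
weights of `A` and `A'` differ by at most `(s - 1) / (s + 1)` (stated without division). -/
theorem add_one_mul_sub_div_add_le {A B A' B' s : ℝ} (hA : 0 < A) (hB : 0 ≤ B) (hA' : 0 < A')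
    (hB' : 0 ≤ B') (hs : 1 ≤ s) (h₁ : A ≤ s * A') (h₂ : B' ≤ s * B) :
    (s + 1) * (A / (A + B) - A' / (A' + B')) ≤ s - 1 := by
  have hu : 0 ≤ A * B' := by positivity
  have hv : 0 ≤ A' * B := by positivity
  obtain ⟨p, hp0, hp⟩ : ∃ p, 0 ≤ p ∧ p ^ 2 = A * B' := ⟨_, Real.sqrt_nonneg _, Real.sq_sqrt hu⟩
  obtain ⟨q, hq0, hq⟩ : ∃ q, 0 ≤ q ∧ q ^ 2 = A' * B := ⟨_, Real.sqrt_nonneg _, Real.sq_sqrt hv⟩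
  have hpq : p ≤ s * q := by
    apply le_of_sq_le_sq _ (by positivity)
    calc p ^ 2 = A * B' := hp
      _ ≤ (s * A') * (s * B) := by gcongr
      _ = (s * q) ^ 2 := by rw [mul_pow, hq]; ring
  have hamgm : 2 * (p * q) ≤ A * A' + B * B' := by
    apply le_of_sq_le_sq _ (by positivity)
    have : (2 * (p * q)) ^ 2 = 4 * ((A * B') * (A' * B)) := by rw [← hp, ← hq]; ring
    rw [this]
    nlinarith [sq_nonneg (A * A' - B * B')]
  have hAB : 0 < A + B := by positivity
  have hAB' : 0 < A' + B' := by positivity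
  rw [div_sub_div _ _ hAB.ne' hAB'.ne', ← mul_div_assoc, div_le_iff₀ (by positivity)]
  have h₃ := mul_le_mul_of_nonneg_left hamgm (sub_nonneg.2 hs)
  have h₄ := mul_nonneg (sub_nonneg.2 hpq) (add_nonneg hp0 hq0)
  linear_combination h₃ + 2 * h₄ - 2 * hp + 2 * s * hq

/-- One-sided coordinatewise Lipschitz estimate for softmax, with constant `lam`. -/
theorem softmaxFin_sub_le {N : ℕ} {lam : ℝ} (hlam : 0 < lam) (x y : Fin N → ℝ) (i : Fin N) :
    softmaxFin lam x i - softmaxFin lam y i ≤ lam * ‖x - y‖ := by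
  have ht : 0 ≤ lam * ‖x - y‖ := by positivity
  have hexp : ∀ u v : Fin N → ℝ, ∀ j, Real.exp (lam * u j) ≤
      Real.exp (lam * ‖u - v‖) * Real.exp (lam * v j) := by
    intro u v j
    rw [← Real.exp_add, Real.exp_le_exp, ← mul_add]
    have h := (le_abs_self _).trans (norm_le_pi_norm (u - v) j)
    rw [Pi.sub_apply] at h
    exact mul_le_mul_of_nonneg_left (by linarith) hlam.le
  have hsum : ∀ u : Fin N → ℝ, ∑ j, Real.exp (lam * u j) =
      Real.exp (lam * u i) + ∑ j ∈ Finset.univ.erase i, Real.exp (lam * u j) := fun u =>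
    (Finset.add_sum_erase _ _ (Finset.mem_univ i)).symm
  have key := add_one_mul_sub_div_add_le (Real.exp_pos (lam * x i))
    (Finset.sum_nonneg fun j (_ : j ∈ Finset.univ.erase i) => (Real.exp_pos (lam * x j)).le)
    (Real.exp_pos (lam * y i))
    (Finset.sum_nonneg fun j (_ : j ∈ Finset.univ.erase i) => (Real.exp_pos (lam * y j)).le)
    (Real.one_le_exp ht) (hexp x y i)
    (by
      rw [Finset.mul_sum]
      refine Finset.sum_le_sum fun j _ => ?_
      rw [norm_sub_rev]
      exact hexp y x j)
  rw [← hsum, ← hsum] at key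
  change _ * (softmaxFin lam x i - softmaxFin lam y i) ≤ _ at key
  set t := lam * ‖x - y‖
  have hs : Real.exp t - 1 ≤ t * Real.exp t := by
    have h := mul_le_mul_of_nonneg_right (Real.add_one_le_exp (-t)) (Real.exp_pos t).le
    rw [← Real.exp_add, neg_add_cancel, Real.exp_zero] at h
    linarith
  have hpos : 0 < Real.exp t + 1 := by positivity
  refine le_of_mul_le_mul_left ?_ hpos
  linarith

/-- The softmax with inverse temperature `lam > 0` is Lipschitz with
constant `lam·√N` with respect to the supremum norm on `ℝ^N` (the norm of `Fin N → ℝ`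
is the supremum norm). -/
theorem softmax_lipschitz_sup (N : ℕ) (lam : ℝ) (hlam : 0 < lam) (x y : Fin N → ℝ) :
    ‖softmaxFin lam x - softmaxFin lam y‖ ≤ lam * Real.sqrt N * ‖x - y‖ := by
  refine (pi_norm_le_iff_of_nonneg (by positivity)).2 fun i => ?_
  have hN : (1 : ℝ) ≤ Real.sqrt N := by
    rw [Real.one_le_sqrt]
    exact_mod_cast i.pos
  have h : |softmaxFin lam x i - softmaxFin lam y i| ≤ lam * ‖x - y‖ :=
    abs_sub_le_iff.2 ⟨softmaxFin_sub_le hlam x y i,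
      norm_sub_rev x y ▸ softmaxFin_sub_le hlam y x i⟩
  refine h.trans ?_
  gcongr
  exact le_mul_of_one_le_right hlam.le hN
end

section
/- Let A be a PFSA over a finite alphabet Σ whose induced language model p_A is tight (∑'_{y∈Σ*} p_A(y) = 1), and let ε > 0. Then there exist a ReLU Elman RNN over Σ with hidden-state map h and a ReLU multi-layer perceptron F : ℝ^D → ℝ^{Σ∪{EOS}} (a finite composition F = A_L ∘ (ReLU ∘ A_{L−1}) ∘ ⋯ ∘ (ReLU ∘ A_1) of affine maps A_ℓ with entrywise ReLU between them) such that the language model p_R defined autoregressively by p_R(ā | w) := softmax(F(h(w)))_ā for ā ∈ Σ ∪ {EOS} (softmax with inverse temperature 1) and p_R(y) := p_R(EOS | y)·∏_{t=1}^{|y|} p_R(y_t | y_{<t}) satisfies TVD(p_A, p_R) < ε. -/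
/-- A ReLU multi-layer perceptron from `ℝ^n` to `ℝ^β`: a finite composition
`A_L ∘ (ReLU ∘ A_{L−1}) ∘ ⋯ ∘ (ReLU ∘ A_1)` of affine maps with entrywise ReLU
in between. `last W b` is a single affine map; `layer W b rest` precomposes `rest`
with `ReLU ∘ (affine map)` at the input. -/
inductive ReluMLP (β : Type) : ℕ → Type where
  | last {n : ℕ} (W : Matrix β (Fin n) ℝ) (b : β → ℝ) : ReluMLP β n
  | layer {n k : ℕ} (W : Matrix (Fin k) (Fin n) ℝ) (b : Fin k → ℝ)
      (rest : ReluMLP β k) : ReluMLP β n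

/-- Evaluation of a ReLU MLP. -/
noncomputable def ReluMLP.eval {β : Type} : {n : ℕ} → ReluMLP β n → (Fin n → ℝ) → β → ℝ
  | _, .last W b, x => W.mulVec x + b
  | _, .layer W b rest, x => rest.eval fun i => max 0 ((W.mulVec x + b) i)

/-- Softmax with inverse temperature `1` over `Σ ∪ {EOS}` (`none` is `EOS`). -/
noncomputable def softmaxO {σ : Type} [Fintype σ] (x : Option σ → ℝ) (c : Option σ) : ℝ :=
  Real.exp (x c) / ∑ b, Real.exp (x b)

/-- The weight of a string under the autoregressive model with next-symbol weights `g w c`. -/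
def autoregProb {σ R : Type*} [CommMonoid R] (g : List σ → Option σ → R) (y : List σ) : R :=
  g y none * ∏ t : Fin y.length, g (y.take t.1) (some (y.get t))

theorem autoregProb_nil {σ R : Type*} [CommMonoid R] (g : List σ → Option σ → R) :
    autoregProb g [] = g [] none := by
  simp [autoregProb]

theorem autoregProb_cons {σ R : Type*} [CommMonoid R] (g : List σ → Option σ → R)
    (a : σ) (y : List σ) :
    autoregProb g (a :: y) = g [] (some a) * autoregProb (fun w => g (a :: w)) y := by
  simp only [autoregProb, List.length_cons, Fin.prod_univ_succ]
  rw [mul_left_comm]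
  rfl

/-- A list is either empty or has a head and a tail. -/
def listEquivSum (σ : Type*) : Unit ⊕ (σ × List σ) ≃ List σ where
  toFun x := x.elim (fun _ => []) fun p => p.1 :: p.2
  invFun
    | [] => .inl ()
    | a :: y => .inr (a, y)
  left_inv x := by cases x <;> rfl
  right_inv y := by cases y <;> rfl

theorem sum_autoregProb_le_one_of_length_lt {σ : Type*} [Fintype σ] (n : ℕ) :
    ∀ g : List σ → Option σ → ℝ, (∀ w c, 0 ≤ g w c) → (∀ w, ∑ c, g w c ≤ 1) →
      ∀ s : Finset (List σ), (∀ y ∈ s, y.length < n) → ∑ y ∈ s, autoregProb g y ≤ 1 := by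
  classical
  induction n with
  | zero =>
    intro g _ _ s hs
    rw [Finset.eq_empty_of_forall_notMem fun y hy => Nat.not_lt_zero _ (hs y hy)]
    simp
  | succ n ih =>
    intro g h0 h1 s hs
    have hP : ∀ y, 0 ≤ autoregProb g y := fun y =>
      mul_nonneg (h0 _ _) (Finset.prod_nonneg fun _ _ => h0 _ _)
    let tails : Finset (List σ) := s.image List.tail
    let heads : Finset (σ × List σ) :=
      Finset.univ ×ˢ tails.filter fun y => y.length < n
    have hsub : s ⊆ insert [] (heads.image fun p => p.1 :: p.2) := by
      intro y hy
      cases y with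
      | nil => simp
      | cons a y =>
        have hl := hs _ hy
        simp only [Finset.mem_insert, Finset.mem_image]
        refine Or.inr ⟨(a, y), ?_, rfl⟩
        simp only [heads, tails, Finset.mem_product, Finset.mem_univ, true_and,
          Finset.mem_filter, Finset.mem_image]
        exact ⟨⟨_, hy, rfl⟩, by simpa using hl⟩
    calc ∑ y ∈ s, autoregProb g y
        ≤ ∑ y ∈ insert [] (heads.image fun p => p.1 :: p.2), autoregProb g y :=
          Finset.sum_le_sum_of_subset_of_nonneg hsub fun y _ _ => hP y
      _ = g [] none + ∑ a, g [] (some a) *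
            ∑ y ∈ tails.filter (fun y => y.length < n),
              autoregProb (fun w => g (a :: w)) y := by
          rw [Finset.sum_insert (by simp), autoregProb_nil, Finset.sum_image, Finset.sum_product]
          · simp only [autoregProb_cons, Finset.mul_sum]
          · rintro ⟨a, y⟩ _ ⟨b, z⟩ _ h
            simpa using h
      _ ≤ g [] none + ∑ a, g [] (some a) * 1 := by
          gcongr with a
          · exact h0 _ _
          · exact ih (fun w => g (a :: w)) (fun _ _ => h0 _ _) (fun _ => h1 _) _ fun y hy => (Finset.mem_filter.1 hy).2
      _ ≤ 1 := by simpa [Fintype.sum_option] using h1 []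

theorem sum_autoregProb_le_one {σ : Type*} [Fintype σ] (g : List σ → Option σ → ℝ)
    (h0 : ∀ w c, 0 ≤ g w c) (h1 : ∀ w, ∑ c, g w c ≤ 1) (s : Finset (List σ)) :
    ∑ y ∈ s, autoregProb g y ≤ 1 :=
  sum_autoregProb_le_one_of_length_lt (s.sup List.length + 1) g h0 h1 s fun _ hy =>
    Nat.lt_succ_of_le (Finset.le_sup (f := List.length) hy)

/-- The total weight of all strings extending `w`. -/
noncomputable def prefixMass {σ : Type*} (p : List σ → ℝ) (w : List σ) : ℝ :=
  ∑' y, p (w ++ y)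

theorem summable_append {σ : Type*} {p : List σ → ℝ} (hp : Summable p) (w : List σ) :
    Summable fun y => p (w ++ y) :=
  hp.comp_injective (List.append_right_injective w)

theorem prefixMass_pos {σ : Type*} {p : List σ → ℝ} (hp : Summable p) (h0 : ∀ y, 0 < p y)
    (w : List σ) : 0 < prefixMass p w :=
  (summable_append hp w).tsum_pos (fun _ => (h0 _).le) [] (h0 _)

theorem prefixMass_eq {σ : Type*} [Fintype σ] {p : List σ → ℝ} (hp : Summable p) (w : List σ) :
    prefixMass p w = p w + ∑ a, prefixMass p (w ++ [a]) := by
  have hs := (listEquivSum σ).summable_iff.2 (summable_append hp w)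
  have hl : Summable (((fun y => p (w ++ y)) ∘ listEquivSum σ) ∘ Sum.inl) :=
    hs.comp_injective Sum.inl_injective
  have hr : Summable (((fun y => p (w ++ y)) ∘ listEquivSum σ) ∘ Sum.inr) :=
    hs.comp_injective Sum.inr_injective
  have hsplit : prefixMass p w = ∑' x, ((fun y => p (w ++ y)) ∘ listEquivSum σ) x :=
    ((listEquivSum σ).tsum_eq fun y => p (w ++ y)).symm
  have hprod := hr.tsum_prod
  simp only [Function.comp_apply] at hprod
  rw [hsplit, hl.tsum_sum hr, tsum_fintype]
  simp only [Function.comp_apply, hprod, tsum_fintype]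
  simp [listEquivSum, prefixMass]

/-- Logits of the autoregressive model that realizes a positive summable weight `p`. -/
noncomputable def prefixLogits {σ : Type*} (p : List σ → ℝ) (w : List σ) : Option σ → ℝ
  | none => Real.log (p w)
  | some a => Real.log (prefixMass p (w ++ [a]))

theorem sum_exp_prefixLogits {σ : Type*} [Fintype σ] {p : List σ → ℝ} (hp : Summable p)
    (h0 : ∀ y, 0 < p y) (w : List σ) :
    ∑ c, Real.exp (prefixLogits p w c) = prefixMass p w := by
  simp [Fintype.sum_option, prefixLogits, Real.exp_log (h0 _),
    Real.exp_log (prefixMass_pos hp h0 _), prefixMass_eq hp w]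

theorem softmaxO_nonneg {σ : Type} [Fintype σ] (x : Option σ → ℝ) (c : Option σ) :
    0 ≤ softmaxO x c := by
  unfold softmaxO
  positivity

theorem sum_softmaxO {σ : Type} [Fintype σ] (x : Option σ → ℝ) : ∑ c, softmaxO x c = 1 := by
  unfold softmaxO
  rw [← Finset.sum_div]
  exact div_self (Finset.sum_pos (fun _ _ => Real.exp_pos _) Finset.univ_nonempty).ne'

theorem prod_range_div_of_ne_zero {G : Type*} [CommGroupWithZero G] (f : ℕ → G)
    (hf : ∀ i, f i ≠ 0) (n : ℕ) : ∏ i ∈ Finset.range n, f (i + 1) / f i = f n / f 0 := by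
  induction n with
  | zero => simp [hf]
  | succ n ih => rw [Finset.prod_range_succ, ih, mul_comm, div_mul_div_cancel₀ (hf n)]

theorem autoregProb_softmaxO_eq {σ : Type} [Fintype σ] {p : List σ → ℝ} (hp : Summable p)
    (h0 : ∀ y, 0 < p y) (l : List σ → Option σ → ℝ) (y : List σ)
    (hl : ∀ t ≤ y.length, l (y.take t) = prefixLogits p (y.take t)) :
    autoregProb (fun w => softmaxO (l w)) y = p y / ∑' z, p z := by
  have hm := prefixMass_pos hp h0
  have hprod : ∏ t : Fin y.length, softmaxO (l (y.take t.1)) (some (y.get t)) =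
      prefixMass p y / prefixMass p [] := by
    have hstep : ∀ t : Fin y.length, softmaxO (l (y.take t.1)) (some (y.get t)) =
        prefixMass p (y.take (t.1 + 1)) / prefixMass p (y.take t.1) := by
      intro t
      rw [hl _ t.2.le, softmaxO, sum_exp_prefixLogits hp h0, prefixLogits,
        Real.exp_log (hm _)]
      simp
    rw [Finset.prod_congr rfl fun t _ => hstep t,
      Fin.prod_univ_eq_prod_range
        (fun t => prefixMass p (y.take (t + 1)) / prefixMass p (y.take t)) y.length,
      prod_range_div_of_ne_zero (fun t => prefixMass p (y.take t)) fun _ => (hm _).ne']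
    simp
  have hend : softmaxO (l y) none = p y / prefixMass p y := by
    have := hl _ le_rfl
    rw [List.take_length] at this
    rw [this, softmaxO, sum_exp_prefixLogits hp h0, prefixLogits, Real.exp_log (h0 _)]
  have hnil : prefixMass p [] = ∑' z, p z := rfl
  rw [autoregProb, hprod, hend, ← hnil, div_mul_div_cancel₀ (hm _).ne']

theorem exists_relu_coeffs (f : ℕ → ℝ) (M : ℕ) :
    ∃ c : ℕ → ℝ, ∀ m ≤ M,
      ∑ i ∈ Finset.range M, c i * max 0 ((m : ℝ) - i) + f 0 = f m := by
  induction M with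
  | zero => exact ⟨0, fun m hm => by simp [Nat.le_zero.1 hm]⟩
  | succ M ih =>
    obtain ⟨c, hc⟩ := ih
    let r := f (M + 1) - f 0 - ∑ i ∈ Finset.range M, c i * max 0 (((M + 1 : ℕ) : ℝ) - i)
    have hsum : ∀ m : ℕ, ∑ i ∈ Finset.range M, Function.update c M r i * max 0 ((m : ℝ) - i) =
        ∑ i ∈ Finset.range M, c i * max 0 ((m : ℝ) - i) := fun m =>
      Finset.sum_congr rfl fun i hi => by
        rw [Function.update_of_ne (Finset.mem_range.1 hi).ne]
    refine ⟨Function.update c M r, fun m hm => ?_⟩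
    rw [Finset.sum_range_succ, hsum, Function.update_self]
    rcases Nat.le_succ_iff.1 hm with hm | rfl
    · have : (m : ℝ) - M ≤ 0 := sub_nonpos.2 (Nat.cast_le.2 hm)
      rw [max_eq_left this, mul_zero, add_zero, hc m hm]
    · have : max 0 (((M + 1 : ℕ) : ℝ) - M) = 1 := by simp
      rw [Nat.succ_eq_add_one, this]
      simp only [r]
      ring

/-- A ReLU MLP with one hidden layer interpolates any values at finitely many naturals. -/
theorem exists_reluMLP_eval_eq {β : Type} (f : ℕ → β → ℝ) (M : ℕ) :
    ∃ F : ReluMLP β 1, ∀ m ≤ M, F.eval (fun _ => (m : ℝ)) = f m := by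
  choose c hc using fun b => exists_relu_coeffs (fun m => f m b) M
  refine ⟨.layer (fun (_ : Fin M) _ => 1) (fun i => -(i : ℝ))
    (.last (fun b i => c b i) (f 0)), fun m hm => funext fun b => ?_⟩
  rw [← hc b m hm, ← Fin.sum_univ_eq_sum_range (fun i => c b i * max 0 ((m : ℝ) - i))]
  simp [ReluMLP.eval, Matrix.mulVec, dotProduct, sub_eq_add_neg]

/-- Injective numeration of strings: base `|σ| + 1` with nonzero digits. -/
noncomputable def stringCode {σ : Type*} [Fintype σ] (y : List σ) : ℕ :=
  y.foldl (fun v a => (Fintype.card σ + 1) * v + (Fintype.equivFin σ a + 1)) 0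

theorem stringCode_concat {σ : Type*} [Fintype σ] (y : List σ) (a : σ) :
    stringCode (y ++ [a]) =
      (Fintype.card σ + 1) * stringCode y + (Fintype.equivFin σ a + 1) := by
  simp [stringCode]

theorem stringCode_injective {σ : Type*} [Fintype σ] :
    Function.Injective (stringCode (σ := σ)) := by
  intro y
  induction y using List.reverseRecOn with
  | nil =>
    intro z h
    cases z using List.reverseRecOn with
    | nil => rfl
    | append_singleton z b => simp [stringCode] at h
  | append_singleton y a ih =>
    intro z h
    cases z using List.reverseRecOn with
    | nil => simp [stringCode] at h
    | append_singleton z b =>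
      rw [stringCode_concat, stringCode_concat] at h
      have ha : (Fintype.equivFin σ a : ℕ) + 1 < Fintype.card σ + 1 := by simp
      have hb : (Fintype.equivFin σ b : ℕ) + 1 < Fintype.card σ + 1 := by simp
      have hmod := congrArg (· % (Fintype.card σ + 1)) h
      have hdiv := congrArg (· / (Fintype.card σ + 1)) h
      simp only [Nat.mul_add_mod, Nat.mod_eq_of_lt ha, Nat.mod_eq_of_lt hb] at hmod
      simp only [Nat.mul_add_div (Nat.succ_pos _), Nat.div_eq_of_lt ha,
        Nat.div_eq_of_lt hb, add_zero] at hdiv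
      have hab : a = b := (Fintype.equivFin σ).injective (Fin.ext (Nat.succ_injective hmod))
      rw [ih hdiv, hab]

/-- A one-neuron Elman RNN whose hidden state is the code of the string read so far. -/
noncomputable def codeRNN (σ : Type) [Fintype σ] : ElmanRNN σ (Fin 1) where
  U _ _ := Fintype.card σ + 1
  V _ a := (Fintype.equivFin σ a : ℕ) + 1
  bias := 0
  init := 0

theorem codeRNN_hid {σ : Type} [Fintype σ] [DecidableEq σ] (y : List σ) :
    (codeRNN σ).hid y = fun _ => (stringCode y : ℚ) := by
  induction y using List.reverseRecOn with
  | nil => rfl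
  | append_singleton y a ih =>
    have hstep : (codeRNN σ).hid (y ++ [a]) = fun d =>
        max 0 (((codeRNN σ).U.mulVec ((codeRNN σ).hid y) +
          (codeRNN σ).V.mulVec (oneHot a) + (codeRNN σ).bias) d) := by
      simp [ElmanRNN.hid]
    rw [hstep, ih, stringCode_concat]
    funext d
    simp only [codeRNN, oneHot, Matrix.mulVec, dotProduct, Pi.add_apply, Pi.zero_apply,
      Finset.univ_unique, Finset.sum_singleton, mul_ite, mul_one, mul_zero,
      Finset.sum_ite_eq', Finset.mem_univ, if_true, add_zero]
    rw [max_eq_right (by positivity)]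
    push_cast
    ring

theorem PFSA.prefixVec_nonneg_s15 {σ Q : Type} [Fintype σ] [Fintype Q] (A : PFSA σ Q)
    (y : List σ) : ∀ q, 0 ≤ A.prefixVec y q := by
  induction y using List.reverseRecOn with
  | nil => exact A.init_nonneg
  | append_singleton y a ih =>
    intro q
    simp only [PFSA.prefixVec, List.foldl_append, List.foldl_cons, List.foldl_nil]
    exact Finset.sum_nonneg fun q' _ => mul_nonneg (ih q') (A.T_nonneg _ _ _)

theorem PFSA.stringProb_nonneg {σ Q : Type} [Fintype σ] [Fintype Q] (A : PFSA σ Q)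
    (y : List σ) : 0 ≤ A.stringProb y :=
  Finset.sum_nonneg fun q _ => mul_nonneg (A.prefixVec_nonneg_s15 y q) (A.final_nonneg q)

/-- If `P` is a subprobability that dominates `r • p` on a finite set of large `p`-mass, then
`P` is close to the probability `p` in `ℓ¹`. -/
theorem tsum_abs_sub_le {ι : Type*} {p P : ι → ℝ} (hp : HasSum p 1) (hp0 : ∀ i, 0 ≤ p i)
    (hP0 : ∀ i, 0 ≤ P i) (hP : ∀ s : Finset ι, ∑ i ∈ s, P i ≤ 1) {r : ℝ} (hr : r ≤ 1)
    (S : Finset ι) (hS : ∀ i ∈ S, r * p i ≤ P i) :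
    ∑' i, |p i - P i| ≤ 2 - 2 * (r * ∑ i ∈ S, p i) := by
  classical
  have key : ∀ s : Finset ι, ∑ i ∈ s, |p i - P i| ≤ 2 - 2 * (r * ∑ i ∈ S, p i) := by
    intro s
    calc ∑ i ∈ s, |p i - P i| ≤ ∑ i ∈ s ∪ S, |p i - P i| :=
          Finset.sum_le_sum_of_subset_of_nonneg Finset.subset_union_left
            fun _ _ _ => abs_nonneg _
      _ ≤ ∑ i ∈ s ∪ S, (p i + P i - if i ∈ S then 2 * (r * p i) else 0) := by
          gcongr with i
          split_ifs with h
          · have h1 := hS i h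
            have h2 := mul_le_of_le_one_left (hp0 i) hr
            rw [abs_le]
            constructor <;> linarith
          · rw [abs_le]
            constructor <;> linarith [hp0 i, hP0 i]
      _ = ∑ i ∈ s ∪ S, p i + ∑ i ∈ s ∪ S, P i - 2 * (r * ∑ i ∈ S, p i) := by
          rw [Finset.sum_sub_distrib, Finset.sum_add_distrib, Finset.sum_ite_mem,
            Finset.inter_eq_right.2 Finset.subset_union_right, Finset.mul_sum, Finset.mul_sum]
      _ ≤ 2 - 2 * (r * ∑ i ∈ S, p i) := by
          linarith [hP (s ∪ S), sum_le_hasSum (s ∪ S) (fun i _ => hp0 i) hp]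
  exact Real.tsum_le_of_sum_le (fun _ => abs_nonneg _) key

/-- For every PFSA `A` with tight induced LM and every `ε > 0`, there
exist a ReLU Elman RNN with hidden-state map `h` and a ReLU MLP
`F : ℝ^D → ℝ^{Σ∪{EOS}}` such that the autoregressive LM defined via
`p_R(c | w) = softmax(F(h(w)))_c` is within total variation distance `ε` of `p_A`. -/
theorem elman_deep_output_approximation
    (σ Q : Type) [Fintype σ] [Fintype Q] [DecidableEq σ] (A : PFSA σ Q)
    (htight : ∑' y : List σ, (A.stringProb y : ℝ) = 1) (ε : ℝ) (hε : 0 < ε) :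
    ∃ (D : ℕ) (R : ElmanRNN σ (Fin D)) (F : ReluMLP (Option σ) D),
      (1 / 2) * (∑' y : List σ,
        |(A.stringProb y : ℝ) -
          softmaxO (F.eval fun d => (R.hid y d : ℝ)) none *
            ∏ t : Fin y.length,
              softmaxO (F.eval fun d => (R.hid (y.take t.1) d : ℝ))
                (some (y.get t))|) < ε := by
  classical
  have hp0 : ∀ y, (0 : ℝ) ≤ A.stringProb y := fun y => by exact_mod_cast A.stringProb_nonneg y
  have hsum : Summable fun y => (A.stringProb y : ℝ) := by
    by_contra h
    simp [tsum_eq_zero_of_not_summable h] at htight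
  have hp : HasSum (fun y => (A.stringProb y : ℝ)) 1 := htight ▸ hsum.hasSum
  obtain ⟨δ, hδ, hδε⟩ : ∃ δ : ℝ, 0 < δ ∧ 2 * δ ≤ ε := ⟨ε / 2, by linarith, by linarith⟩
  have := Encodable.ofCountable (List σ)
  obtain ⟨u, hu0, c, hu, hc⟩ := posSumOfEncodable hδ (List σ)
  have hq := hp.add hu
  have hq0 : ∀ y, 0 < (A.stringProb y : ℝ) + u y := fun y =>
    add_pos_of_nonneg_of_pos (hp0 y) (hu0 y)
  obtain ⟨S, hS⟩ := (hp.eventually_const_lt (show 1 - δ < 1 by linarith)).exists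
  obtain ⟨M, hM⟩ : ∃ M, ∀ y ∈ S, ∀ t ≤ y.length, stringCode (y.take t) ≤ M := by
    refine ⟨S.sup fun y => (Finset.range (y.length + 1)).sup fun t => stringCode (y.take t),
      fun y hy t ht => ?_⟩
    exact (Finset.le_sup (f := fun t => stringCode (y.take t))
      (Finset.mem_range.2 (Nat.lt_succ_of_le ht))).trans
      (Finset.le_sup (f := fun y : List σ =>
        (Finset.range (y.length + 1)).sup fun t => stringCode (y.take t)) hy)
  obtain ⟨F, hF⟩ := exists_reluMLP_eval_eq (fun n =>
    prefixLogits (fun y => (A.stringProb y : ℝ) + u y) (Function.invFun stringCode n)) M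
  refine ⟨1, codeRNN σ, F, ?_⟩
  set g : List σ → Option σ → ℝ := fun w =>
    softmaxO (F.eval fun d => ((codeRNN σ).hid w d : ℝ)) with hg
  have hval : ∀ y ∈ S, autoregProb g y = ((A.stringProb y : ℝ) + u y) / (1 + c) := by
    intro y hy
    rw [hg, autoregProb_softmaxO_eq hq.summable hq0 _ y fun t ht => ?_, hq.tsum_eq]
    have := hF _ (hM y hy t ht)
    rw [Function.leftInverse_invFun stringCode_injective] at this
    simpa [codeRNN_hid] using this
  have hc0 : 0 ≤ c := hu.nonneg fun y => (hu0 y).le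
  have hr : 1 / (1 + δ) ≤ 1 := by
    rw [div_le_one (by linarith)]
    linarith
  have hbound : ∀ y ∈ S, 1 / (1 + δ) * (A.stringProb y : ℝ) ≤ autoregProb g y := by
    intro y hy
    rw [hval y hy, one_div_mul_eq_div]
    have := hp0 y
    have := hu0 y
    gcongr
    linarith
  have hg0 : ∀ w a, 0 ≤ g w a := fun w a => softmaxO_nonneg _ _
  have htv := tsum_abs_sub_le (P := autoregProb g) hp hp0
    (fun y => mul_nonneg (hg0 _ _) (Finset.prod_nonneg fun _ _ => hg0 _ _))
    (sum_autoregProb_le_one g hg0 fun w => (sum_softmaxO _).le) hr S hbound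
  have hfin : 1 - δ * 2 < 1 / (1 + δ) * ∑ y ∈ S, (A.stringProb y : ℝ) := by
    rw [one_div_mul_eq_div, lt_div_iff₀ (by linarith)]
    nlinarith
  change 1 / 2 * ∑' y, |(A.stringProb y : ℝ) - autoregProb g y| < ε
  linarith
end
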